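/- Let T₁, T₂ and T₃ be theories such that the signatures Σ₁ and Σ₂ are disjoint, Σ₂ and Σ₃ are disjoint, and Σ₁ and Σ₃ are disjoint. If T₁ ⋈ T₂ and T₂ ⋈ T₃, then T₁ ⋈ T₃. In other words, restricted to families of theories with pairwise disjoint signatures, definitional mergeability is transitive. -/

import Mathlib

/-!
Formalization framework: first-order logic with equality over purely relational
signatures. A signature is a set `S : Set P` of predicate symbols, where each
symbol `p : P` has arity `ar p`. `Lang ar S` is the corresponding first-order
language, a theory is a set of sentences of that language, and `STheory`
bundles a theory with its signature.
-/

open FirstOrder Language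

namespace DefEqPaper

variable {P : Type} {ar : P → ℕ}

/-- The first-order language (purely relational) of the signature `S`. -/
def Lang (ar : P → ℕ) (S : Set P) : FirstOrder.Language where
  Functions _ := Empty
  Relations n := {p : P // p ∈ S ∧ ar p = n}

/-- A theory together with its signature. -/
structure STheory (P : Type) (ar : P → ℕ) where
  sig : Set P
  th : (Lang ar sig).Theory

/-- The inclusion of languages induced by an inclusion of signatures. -/
def langIncl {S S' : Set P} (h : S ⊆ S') : Lang ar S →ᴸ Lang ar S' where
  onFunction _ f := f.elim
  onRelation _ r := ⟨r.1, h r.2.1, r.2.2⟩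

/-- Logical equivalence: two theories of the same language having the same class
of models. -/
def TheoryEquiv {L : FirstOrder.Language} (T T' : L.Theory) : Prop :=
  ∀ (M : Type) [L.Structure M] [Nonempty M], (M ⊨ T ↔ M ⊨ T')

/-- The explicit definition `∀ x₁ … xₙ (p(x₁,…,xₙ) ↔ φ(x₁,…,xₙ))` of a relation
symbol `p ∈ S'` by a formula `φ` of the language of `S`, as a sentence of the
language of `S'`. -/
def explicitDef {S S' : Set P} (h : S ⊆ S') {p : P} (hp : p ∈ S')
    (φ : (Lang ar S).Formula (Fin (ar p))) : (Lang ar S').Sentence :=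
  (BoundedFormula.iff
    (Relations.boundedFormula (⟨p, hp, rfl⟩ : (Lang ar S').Relations (ar p))
      (fun i => Term.var (Sum.inr i)))
    (BoundedFormula.relabel Sum.inr ((langIncl h).onFormula φ))).alls

/-- `Δ` is a set consisting of one explicit definition, in terms of the language
of `S`, for each relation symbol of `S' \ S`. -/
def IsDefinitionSet {S S' : Set P} (h : S ⊆ S') (Δ : Set ((Lang ar S').Sentence)) : Prop :=
  ∃ d : (p : P) → p ∈ S' → p ∉ S → (Lang ar S).Formula (Fin (ar p)),
    Δ = {σ | ∃ (p : P) (hp : p ∈ S') (hn : p ∉ S), σ = explicitDef h hp (d p hp hn)}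

/-- `T'` is a definitional extension of `T`: the signature of `T'` contains that of
`T` and `T'` is logically equivalent to `T ∪ Δ` for a set `Δ` of explicit
definitions, in terms of the language of `T`, of the new relation symbols. -/
def DefExt (T T' : STheory P ar) : Prop :=
  ∃ h : T.sig ⊆ T'.sig, ∃ Δ : Set ((Lang ar T'.sig).Sentence),
    IsDefinitionSet h Δ ∧ TheoryEquiv ((langIncl h).onTheory T.th ∪ Δ) T'.th

/-- `T₁` and `T₂` are definitionally mergeable (Barrett–Halvorson): they have a
common definitional extension. -/
def Mergeable (T₁ T₂ : STheory P ar) : Prop :=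
  ∃ T' : STheory P ar, DefExt T₁ T' ∧ DefExt T₂ T'

/-- Definitional equivalence (Andréka–Németi): there is a finite chain of theories
connecting `T` and `T'` in which each consecutive pair is related by definitional
extension in one direction or the other. -/
def DefEquiv : STheory P ar → STheory P ar → Prop :=
  Relation.ReflTransGen (fun T T' => DefExt T T' ∨ DefExt T' T)

/-- Renaming of signatures along an arity-preserving map, as a map of languages. -/
def renameLHom {S S' : Set P} (ρ : P → P) (hmap : Set.MapsTo ρ S S')
    (har : ∀ p ∈ S, ar (ρ p) = ar p) : Lang ar S →ᴸ Lang ar S' where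
  onFunction _ f := f.elim
  onRelation _ r := ⟨ρ r.1, hmap r.2.1, (har r.1 r.2.1).trans r.2.2⟩

/-- `T'` is a disjoint renaming of `T`: their signatures are disjoint and there is
an arity-preserving bijection between the signatures under which the sentences of
`T'` are exactly the renamings of the sentences of `T`. -/
def IsDisjointRenaming (T T' : STheory P ar) : Prop :=
  Disjoint T.sig T'.sig ∧
    ∃ (ρ : P → P) (hbij : Set.BijOn ρ T.sig T'.sig)
      (har : ∀ p ∈ T.sig, ar (ρ p) = ar p),
      T'.th = (renameLHom ρ hbij.mapsTo har).onTheory T.th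

/-- The variable of a term of a purely relational language. -/
def termVar {S : Set P} {β : Type} : (Lang ar S).Term β → β
  | .var v => v
  | .func f _ => f.elim

/-- The translation of formulas induced by a map `t` sending each `n`-ary relation
symbol of the language of `S₁` to a formula of the language of `S₂` with (at most)
`n` free variables.  It maps `p(x₁,…,xₙ)` to `(t p)(x₁,…,xₙ)` and commutes with
equality and all connectives and quantifiers. -/
def trBF {S₁ S₂ : Set P} (t : ∀ n, (Lang ar S₁).Relations n → (Lang ar S₂).Formula (Fin n)) :
    ∀ {α : Type} {n : ℕ}, (Lang ar S₁).BoundedFormula α n → (Lang ar S₂).BoundedFormula α n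
  | _, _, .falsum => .falsum
  | _, _, .equal t₁ t₂ => .equal (.var (termVar t₁)) (.var (termVar t₂))
  | _, _, .rel R ts => BoundedFormula.relabel (fun i => termVar (ts i)) (t _ R)
  | _, _, .imp f g => (trBF t f).imp (trBF t g)
  | _, _, .all f => (trBF t f).all

/-- `φ` is a semantic consequence of the theory `T`. -/
def Conseq {L : FirstOrder.Language} (T : L.Theory) (φ : L.Sentence) : Prop :=
  ∀ (M : Type) [L.Structure M] [Nonempty M], M ⊨ T → M ⊨ φ

/-- The map `t` on relation symbols induces a translation of the theory `T₁` to the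
theory `T₂`: it maps consequences of `T₁` to consequences of `T₂`. -/
def IsTranslation (T₁ T₂ : STheory P ar)
    (t : ∀ n, (Lang ar T₁.sig).Relations n → (Lang ar T₂.sig).Formula (Fin n)) : Prop :=
  ∀ φ : (Lang ar T₁.sig).Sentence, Conseq T₁.th φ → Conseq T₂.th (trBF t φ)

/-- `T₁` and `T₂` are intertranslatable: there are translations `t₁₂` of `T₁` to `T₂`
and `t₂₁` of `T₂` to `T₁` such that
`T₁ ⊨ ∀ x̄ (φ(x̄) ↔ tr₂₁(tr₁₂(φ(x̄))))` for every formula `φ` of the language of `T₁`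
and `T₂ ⊨ ∀ x̄ (ψ(x̄) ↔ tr₁₂(tr₂₁(ψ(x̄))))` for every formula `ψ` of the language of `T₂`. -/
def Intertranslatable (T₁ T₂ : STheory P ar) : Prop :=
  ∃ (t₁₂ : ∀ n, (Lang ar T₁.sig).Relations n → (Lang ar T₂.sig).Formula (Fin n))
    (t₂₁ : ∀ n, (Lang ar T₂.sig).Relations n → (Lang ar T₁.sig).Formula (Fin n)),
    IsTranslation T₁ T₂ t₁₂ ∧ IsTranslation T₂ T₁ t₂₁ ∧
    (∀ (n : ℕ) (φ : (Lang ar T₁.sig).BoundedFormula Empty n),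
      Conseq T₁.th ((φ.iff (trBF t₂₁ (trBF t₁₂ φ))).alls)) ∧
    (∀ (n : ℕ) (ψ : (Lang ar T₂.sig).BoundedFormula Empty n),
      Conseq T₂.th ((ψ.iff (trBF t₁₂ (trBF t₂₁ ψ))).alls))

/-- The structure `tr*(𝔐)` induced on the underlying set of a structure `𝔐` for the
language of `S₂` by a translation-map `t`: each relation symbol `R` is interpreted by
the relation defined by the formula `t R` in `𝔐`. -/
def trStruc {S₁ S₂ : Set P} (t : ∀ n, (Lang ar S₁).Relations n → (Lang ar S₂).Formula (Fin n))
    (M : Type) (inst : (Lang ar S₂).Structure M) : (Lang ar S₁).Structure M where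
  funMap f _ := f.elim
  RelMap {n} R x := letI := inst; (t n R).Realize x

end DefEqPaper

namespace DefEqPaper

section Semantics

variable {P : Type} {ar : P → ℕ}

/-- The reduct of a structure to a smaller signature. -/
@[reducible] def reductStruc {S S' : Set P} (h : S ⊆ S') (M : Type)
    (inst : (Lang ar S').Structure M) : (Lang ar S).Structure M :=
  letI := inst; (langIncl h).reduct M

/-- `M`, with the structure `inst`, is a model of `T`. -/
def ModelOf {L : FirstOrder.Language} (T : L.Theory) (M : Type) (inst : L.Structure M) : Prop :=
  letI := inst; M ⊨ T

/-- The formula `φ` holds of `x` in `M` with the structure `inst`. -/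
def Holds {L : FirstOrder.Language} {n : ℕ} (M : Type) (inst : L.Structure M)
    (φ : L.Formula (Fin n)) (x : Fin n → M) : Prop :=
  letI := inst; φ.Realize x

theorem struc_ext {S : Set P} {M : Type} {A B : (Lang ar S).Structure M}
    (h : ∀ (p : P) (hp : p ∈ S) (x : Fin (ar p) → M),
      A.RelMap (⟨p, hp, rfl⟩ : (Lang ar S).Relations (ar p)) x ↔
        B.RelMap (⟨p, hp, rfl⟩ : (Lang ar S).Relations (ar p)) x) : A = B := by
  apply Structure.ext
  · funext n f
    exact f.elim
  · funext n R x
    obtain ⟨p, hp, rfl⟩ := R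
    exact propext (h p hp x)

theorem realize_explicitDef {S S' : Set P} (h : S ⊆ S') {p : P} (hp : p ∈ S')
    (φ : (Lang ar S).Formula (Fin (ar p))) (M : Type) [inst : (Lang ar S').Structure M] :
    M ⊨ explicitDef h hp φ ↔ ∀ x : Fin (ar p) → M,
      (inst.RelMap (⟨p, hp, rfl⟩ : (Lang ar S').Relations (ar p)) x ↔
        Holds M (reductStruc h M inst) φ x) := by
  let := reductStruc h M inst
  have : (langIncl h : Lang ar S →ᴸ Lang ar S').IsExpansionOn M :=
    LHom.isExpansionOn_reduct _ _
  refine BoundedFormula.realize_alls.trans (forall_congr' fun x => ?_)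
  refine BoundedFormula.realize_iff.trans (iff_congr BoundedFormula.realize_rel ?_)
  refine (BoundedFormula.realize_relabel (n := 0)).trans ?_
  refine Iff.trans ?_ (LHom.realize_onFormula (langIncl h) φ (v := x))
  unfold Formula.Realize
  exact iff_of_eq (congrArg₂ _ (by funext i; rfl) (Subsingleton.elim _ _))

theorem modelOf_reductStruc {S S' : Set P} (h : S ⊆ S') (T : (Lang ar S).Theory) (M : Type)
    (inst : (Lang ar S').Structure M) :
    ModelOf ((langIncl h).onTheory T) M inst ↔ ModelOf T M (reductStruc h M inst) := by
  let := reductStruc h M inst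
  have : (langIncl h : Lang ar S →ᴸ Lang ar S').IsExpansionOn M :=
    LHom.isExpansionOn_reduct _ _
  exact LHom.onTheory_model (langIncl h) T

/-- The new relations of the structure `inst` are those defined in its reduct by `d`. -/
def SatisfiesDefs {S S' : Set P} (h : S ⊆ S')
    (d : (p : P) → p ∈ S' → p ∉ S → (Lang ar S).Formula (Fin (ar p)))
    (M : Type) (inst : (Lang ar S').Structure M) : Prop :=
  ∀ (p : P) (hp : p ∈ S') (hn : p ∉ S) (x : Fin (ar p) → M),
    inst.RelMap (⟨p, hp, rfl⟩ : (Lang ar S').Relations (ar p)) x ↔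
      Holds M (reductStruc h M inst) (d p hp hn) x

theorem modelOf_definitions {S S' : Set P} (h : S ⊆ S')
    (d : (p : P) → p ∈ S' → p ∉ S → (Lang ar S).Formula (Fin (ar p)))
    (T : (Lang ar S).Theory) (M : Type) (inst : (Lang ar S').Structure M) :
    ModelOf ((langIncl h).onTheory T ∪
      {σ | ∃ (p : P) (hp : p ∈ S') (hn : p ∉ S), σ = explicitDef h hp (d p hp hn)}) M inst ↔
      ModelOf T M (reductStruc h M inst) ∧ SatisfiesDefs h d M inst := by
  rw [← modelOf_reductStruc]
  unfold ModelOf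
  rw [Theory.model_union_iff]
  refine and_congr Iff.rfl ?_
  rw [Theory.model_iff]
  constructor
  · intro H p hp hn
    exact (realize_explicitDef h hp _ M).1 (H _ ⟨p, hp, hn, rfl⟩)
  · rintro H _ ⟨p, hp, hn, rfl⟩
    exact (realize_explicitDef h hp _ M).2 (H p hp hn)

theorem defExt_iff {T T' : STheory P ar} : DefExt T T' ↔
    ∃ (h : T.sig ⊆ T'.sig)
      (d : (p : P) → p ∈ T'.sig → p ∉ T.sig → (Lang ar T.sig).Formula (Fin (ar p))),
      ∀ (M : Type) [Nonempty M] (inst : (Lang ar T'.sig).Structure M),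
        ModelOf T'.th M inst ↔
          ModelOf T.th M (reductStruc h M inst) ∧ SatisfiesDefs h d M inst := by
  constructor
  · rintro ⟨h, _, ⟨d, rfl⟩, H⟩
    refine ⟨h, d, fun M _ inst => ?_⟩
    rw [← modelOf_definitions]
    exact (H M).symm
  · rintro ⟨h, d, H⟩
    refine ⟨h, _, ⟨d, rfl⟩, fun M inst _ => ?_⟩
    exact (modelOf_definitions h d T.th M inst).trans (H M inst).symm

open Classical in
/-- The expansion of a structure by the relations defined by `d`. -/
@[reducible] def expandStruc {S S' : Set P}
    (d : (p : P) → p ∈ S' → p ∉ S → (Lang ar S).Formula (Fin (ar p)))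
    (M : Type) (inst : (Lang ar S).Structure M) : (Lang ar S').Structure M where
  funMap f _ := f.elim
  RelMap {_} R x :=
    if h : R.1 ∈ S then inst.RelMap (⟨R.1, h, R.2.2⟩ : (Lang ar S).Relations _) x
    else Holds M inst (d R.1 R.2.1 h) (x ∘ Fin.cast R.2.2)

theorem reductStruc_expandStruc {S S' : Set P} (h : S ⊆ S')
    (d : (p : P) → p ∈ S' → p ∉ S → (Lang ar S).Formula (Fin (ar p)))
    (M : Type) (inst : (Lang ar S).Structure M) :
    reductStruc h M (expandStruc d M inst) = inst := by
  refine struc_ext fun p hp x => ?_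
  exact iff_of_eq (dif_pos hp)

theorem satisfiesDefs_expandStruc {S S' : Set P} (h : S ⊆ S')
    (d : (p : P) → p ∈ S' → p ∉ S → (Lang ar S).Formula (Fin (ar p)))
    (M : Type) (inst : (Lang ar S).Structure M) :
    SatisfiesDefs h d M (expandStruc d M inst) := by
  intro p hp hn x
  rw [reductStruc_expandStruc]
  exact iff_of_eq (dif_neg hn)

theorem realize_trBF {S₁ S₂ : Set P}
    (t : ∀ n, (Lang ar S₁).Relations n → (Lang ar S₂).Formula (Fin n))
    (M : Type) (inst : (Lang ar S₂).Structure M) {α : Type} {n : ℕ}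
    (φ : (Lang ar S₁).BoundedFormula α n) (v : α → M) (xs : Fin n → M) :
    (trBF t φ).Realize v xs ↔
      @BoundedFormula.Realize (Lang ar S₁) M (trStruc t M inst) α n φ v xs := by
  let := trStruc t M inst
  have var_eq : ∀ {β : Type} (s : (Lang ar S₁).Term β) (w : β → M),
      w (termVar s) = s.realize w := by
    intro β s w
    cases s with
    | var v => rfl
    | func f _ => exact f.elim
  induction φ with
  | falsum => rw [trBF]; exact Iff.rfl
  | equal t₁ t₂ =>
    rw [trBF]
    refine iff_of_eq (congrArg₂ (· = ·) ?_ ?_)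
    · exact var_eq t₁ _
    · exact var_eq t₂ _
  | rel R ts =>
    rw [trBF]
    refine (BoundedFormula.realize_relabel (n := 0)).trans ?_
    refine iff_of_eq (congrArg₂ (BoundedFormula.Realize (t _ R)) ?_ (Subsingleton.elim _ _))
    funext i
    exact var_eq (ts i) _
  | imp f g hf hg => rw [trBF]; exact imp_congr (hf xs) (hg xs)
  | all f hf => rw [trBF]; exact forall_congr' fun a => hf _

/-- The translation-map `t` sends models of `T₁` to models of `T₂`, and the translation-map `s`
recovers the original model. -/
def IsRetract (T₁ T₂ : STheory P ar)
    (t : ∀ n, (Lang ar T₂.sig).Relations n → (Lang ar T₁.sig).Formula (Fin n))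
    (s : ∀ n, (Lang ar T₁.sig).Relations n → (Lang ar T₂.sig).Formula (Fin n)) : Prop :=
  ∀ (M : Type) [Nonempty M] (inst : (Lang ar T₁.sig).Structure M), ModelOf T₁.th M inst →
    ModelOf T₂.th M (trStruc t M inst) ∧ trStruc s M (trStruc t M inst) = inst

/-- The composite of two translation-maps. -/
def trComp {S₁ S₂ S₃ : Set P}
    (t : ∀ n, (Lang ar S₂).Relations n → (Lang ar S₃).Formula (Fin n))
    (s : ∀ n, (Lang ar S₁).Relations n → (Lang ar S₂).Formula (Fin n)) :
    ∀ n, (Lang ar S₁).Relations n → (Lang ar S₃).Formula (Fin n) :=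
  fun n R => trBF t (s n R)

theorem trStruc_trComp {S₁ S₂ S₃ : Set P}
    (t : ∀ n, (Lang ar S₂).Relations n → (Lang ar S₃).Formula (Fin n))
    (s : ∀ n, (Lang ar S₁).Relations n → (Lang ar S₂).Formula (Fin n))
    (M : Type) (inst : (Lang ar S₃).Structure M) :
    trStruc (trComp t s) M inst = trStruc s M (trStruc t M inst) :=
  struc_ext fun _ _ x => realize_trBF t M inst _ x _

theorem IsRetract.trans {T₁ T₂ T₃ : STheory P ar} {t s t' s'}
    (h : IsRetract T₁ T₂ t s) (h' : IsRetract T₂ T₃ t' s') :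
    IsRetract T₁ T₃ (trComp t t') (trComp s' s) := by
  intro M _ inst hM
  obtain ⟨h₂, e⟩ := h M inst hM
  obtain ⟨h₃, e'⟩ := h' M _ h₂
  rw [trStruc_trComp, trStruc_trComp, e', e]
  exact ⟨h₃, rfl⟩

/-- The translation-map given by explicit definitions of the symbols of `S₂`. -/
def defsMap {S₁ S₂ S' : Set P} (h : S₂ ⊆ S') (hd : Disjoint S₁ S₂)
    (d : (p : P) → p ∈ S' → p ∉ S₁ → (Lang ar S₁).Formula (Fin (ar p))) :
    ∀ n, (Lang ar S₂).Relations n → (Lang ar S₁).Formula (Fin n) :=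
  fun _ R => R.2.2 ▸ d R.1 (h R.2.1) (Set.disjoint_right.1 hd R.2.1)

theorem SatisfiesDefs.reductStruc_eq {S₁ S₂ S' : Set P} {h₁ : S₁ ⊆ S'} (h₂ : S₂ ⊆ S')
    (hd : Disjoint S₁ S₂)
    {d : (p : P) → p ∈ S' → p ∉ S₁ → (Lang ar S₁).Formula (Fin (ar p))}
    {M : Type} {inst : (Lang ar S').Structure M} (H : SatisfiesDefs h₁ d M inst) :
    reductStruc h₂ M inst = trStruc (defsMap h₂ hd d) M (reductStruc h₁ M inst) :=
  struc_ext fun p hp x => H p (h₂ hp) (Set.disjoint_right.1 hd hp) x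

theorem Mergeable.exists_isRetract {T₁ T₂ : STheory P ar} (hd : Disjoint T₁.sig T₂.sig)
    (m : Mergeable T₁ T₂) : ∃ t s, IsRetract T₁ T₂ t s ∧ IsRetract T₂ T₁ s t := by
  obtain ⟨T', D₁, D₂⟩ := m
  obtain ⟨h₁, d₁, H₁⟩ := defExt_iff.1 D₁
  obtain ⟨h₂, d₂, H₂⟩ := defExt_iff.1 D₂
  refine ⟨defsMap h₂ hd d₁, defsMap h₁ hd.symm d₂, fun M _ inst hM => ?_, fun M _ inst hM => ?_⟩
  · have hr := reductStruc_expandStruc h₁ d₁ M inst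
    have hs := satisfiesDefs_expandStruc h₁ d₁ M inst
    have h₃ := (H₂ M _).1 ((H₁ M _).2 ⟨hr.symm ▸ hM, hs⟩)
    have e₁ := hs.reductStruc_eq h₂ hd
    have e₂ := h₃.2.reductStruc_eq h₁ hd.symm
    rw [hr] at e₁ e₂
    rw [e₁] at e₂
    exact ⟨e₁ ▸ h₃.1, e₂.symm⟩
  · have hr := reductStruc_expandStruc h₂ d₂ M inst
    have hs := satisfiesDefs_expandStruc h₂ d₂ M inst
    have h₃ := (H₁ M _).1 ((H₂ M _).2 ⟨hr.symm ▸ hM, hs⟩)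
    have e₁ := hs.reductStruc_eq h₁ hd.symm
    have e₂ := h₃.2.reductStruc_eq h₂ hd
    rw [hr] at e₁ e₂
    rw [e₁] at e₂
    exact ⟨e₁ ▸ h₃.1, e₂.symm⟩

/-- Explicit definitions of the symbols of `S' \ S₁` given by a translation-map. -/
def mapDefs {S₁ S₂ S' : Set P} (h : S' ⊆ S₁ ∪ S₂)
    (t : ∀ n, (Lang ar S₂).Relations n → (Lang ar S₁).Formula (Fin n)) :
    (p : P) → p ∈ S' → p ∉ S₁ → (Lang ar S₁).Formula (Fin (ar p)) :=
  fun p hp hn => t (ar p) ⟨p, (h hp).resolve_left hn, rfl⟩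

theorem satisfiesDefs_mapDefs_iff {S₁ S₂ S' : Set P} (h : S' ⊆ S₁ ∪ S₂) (h₁ : S₁ ⊆ S')
    (h₂ : S₂ ⊆ S') (hd : Disjoint S₁ S₂)
    (t : ∀ n, (Lang ar S₂).Relations n → (Lang ar S₁).Formula (Fin n))
    (M : Type) (inst : (Lang ar S').Structure M) :
    SatisfiesDefs h₁ (mapDefs h t) M inst ↔
      reductStruc h₂ M inst = trStruc t M (reductStruc h₁ M inst) := by
  refine ⟨fun H => struc_ext fun p hp x => H p (h₂ hp) (Set.disjoint_right.1 hd hp) x, fun H p hp hn x => ?_⟩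
  have hp₂ : p ∈ S₂ := (h hp).resolve_left hn
  exact iff_of_eq (congrArg (fun A : (Lang ar S₂).Structure M =>
    A.RelMap (⟨p, hp₂, rfl⟩ : (Lang ar S₂).Relations (ar p)) x) H)

theorem mergeable_of_isRetract {T₁ T₂ : STheory P ar} (hd : Disjoint T₁.sig T₂.sig) {t s}
    (h : IsRetract T₁ T₂ t s) (h' : IsRetract T₂ T₁ s t) : Mergeable T₁ T₂ := by
  have h₁ : T₁.sig ⊆ T₁.sig ∪ T₂.sig := Set.subset_union_left
  have h₂ : T₂.sig ⊆ T₁.sig ∪ T₂.sig := Set.subset_union_right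
  have hc : T₁.sig ∪ T₂.sig ⊆ T₂.sig ∪ T₁.sig := (Set.union_comm _ _).subset
  let d := mapDefs (subset_refl (T₁.sig ∪ T₂.sig)) t
  refine ⟨⟨T₁.sig ∪ T₂.sig, (langIncl h₁).onTheory T₁.th ∪
    {σ | ∃ (p : P) (hp : p ∈ T₁.sig ∪ T₂.sig) (hn : p ∉ T₁.sig),
      σ = explicitDef h₁ hp (d p hp hn)}⟩,
    ⟨h₁, _, ⟨d, rfl⟩, fun _ _ _ => Iff.rfl⟩, defExt_iff.2 ⟨h₂, mapDefs hc s, fun M _ inst => ?_⟩⟩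
  refine (modelOf_definitions h₁ d T₁.th M inst).trans ?_
  rw [satisfiesDefs_mapDefs_iff _ h₁ h₂ hd, satisfiesDefs_mapDefs_iff hc h₂ h₁ hd.symm]
  constructor
  · rintro ⟨hM, e⟩
    rw [e]
    exact (h M _ hM).imp_right Eq.symm
  · rintro ⟨hM, e⟩
    rw [e]
    exact (h' M _ hM).imp_right Eq.symm

end Semantics

/-- Theorem 2: restricted to theories with pairwise disjoint signatures, definitional
mergeability is transitive. -/
theorem mergeable_trans_of_disjoint {P : Type} {ar : P → ℕ} (T₁ T₂ T₃ : STheory P ar)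
    (h12 : Disjoint T₁.sig T₂.sig) (h23 : Disjoint T₂.sig T₃.sig)
    (h13 : Disjoint T₁.sig T₃.sig)
    (m12 : Mergeable T₁ T₂) (m23 : Mergeable T₂ T₃) : Mergeable T₁ T₃ := by
  obtain ⟨_, _, h, h'⟩ := m12.exists_isRetract h12
  obtain ⟨_, _, k, k'⟩ := m23.exists_isRetract h23
  exact mergeable_of_isRetract h13 (h.trans k) (k'.trans h')

end DefEqPaper
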